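/- Let ℓ : ℝ → ℝ be nonnegative, Lipschitz continuous, and convex, let p ∈ (1,∞) be an integer, and let C > 0. Suppose that for every Borel probability distribution F₀ on ℝⁿ with finite p-th moment, every ε ≥ 0, and every D ⊆ ℝⁿ: inf_{β∈D} sup_{F∈B_p(F₀,ε)} E^F[ℓ(β^⊤Z)^p] = inf_{β∈D} ( (E^{F₀}[ℓ(β^⊤Z)^p])^{1/p} + Cε‖β‖_* )^p. Then ℓ = C·ℓ̄ where ℓ̄ has one of the following four forms: ℓ₁(x) = (x−m)₊ for some m ∈ ℝ; ℓ₂(x) = (m−x)₊ for some m ∈ ℝ; ℓ₃(x) = (|x−m₁|−m₂)₊ for some m₁ ∈ ℝ and m₂ ≥ 0; ℓ₄(x) = |x−m| + b for some m ∈ ℝ and b > 0. -/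

import Mathlib

open MeasureTheory Set
open scoped ENNReal NNReal

noncomputable section

abbrev Vec (n : ℕ) := Fin n → ℝ

/-- `β^⊤x` -/
def dotp {n : ℕ} (β x : Vec n) : ℝ := ∑ i, β i * x i

/-- `nrm` is a norm on `ℝⁿ`. -/
def IsNorm {n : ℕ} (nrm : Vec n → ℝ) : Prop :=
  (∀ x, nrm x = 0 ↔ x = 0) ∧
  (∀ (c : ℝ) (x : Vec n), nrm (c • x) = |c| * nrm x) ∧
  (∀ x y : Vec n, nrm (x + y) ≤ nrm x + nrm y)

/-- the dual norm `‖β‖_* = sup_{‖x‖ ≤ 1} β^⊤x`. -/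
def dualNorm {n : ℕ} (nrm : Vec n → ℝ) (β : Vec n) : ℝ :=
  sSup {r | ∃ x, nrm x ≤ 1 ∧ r = dotp β x}

/-- Couplings of two probability measures. -/
def Couplings {E : Type*} [MeasurableSpace E] (μ ν : Measure E) : Set (Measure (E × E)) :=
  {π | IsProbabilityMeasure π ∧ π.map Prod.fst = μ ∧ π.map Prod.snd = ν}

/-- The type-`p` Wasserstein distance (valued in `ℝ≥0∞`) associated with an
extended-real-valued cost; for `p = ∞` it is the infimum over couplings of the essential
supremum of the cost. -/
def WassersteinD {E : Type*} [MeasurableSpace E] (cost : E → E → ℝ≥0∞) (p : ℝ≥0∞)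
    (μ ν : Measure E) : ℝ≥0∞ :=
  if p = ∞ then ⨅ π ∈ Couplings μ ν, essSup (fun z : E × E => cost z.1 z.2) π
  else ⨅ π ∈ Couplings μ ν, (∫⁻ z, cost z.1 z.2 ^ p.toReal ∂π) ^ (1 / p.toReal)

/-- Finite `p`-th moment (with respect to a "norm-like" function `nrm`);
for `p = ∞` it means essential boundedness. -/
def HasMomentP {E : Type*} [MeasurableSpace E] (nrm : E → ℝ) (p : ℝ≥0∞) (μ : Measure E) : Prop :=
  if p = ∞ then essSup (fun x => ENNReal.ofReal (nrm x)) μ ≠ ∞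
  else ∫⁻ x, ENNReal.ofReal (nrm x) ^ p.toReal ∂μ ≠ ∞

/-- The type-`p` Wasserstein ball of probability distributions on `ℝⁿ` (norm `nrm`). -/
def WballVec {n : ℕ} (nrm : Vec n → ℝ) (p : ℝ≥0∞) (μ₀ : Measure (Vec n)) (ε : ℝ) :
    Set (Measure (Vec n)) :=
  {μ | IsProbabilityMeasure μ ∧ HasMomentP nrm p μ ∧
    WassersteinD (fun x y => ENNReal.ofReal (nrm (x - y))) p μ μ₀ ≤ ENNReal.ofReal ε}

/-- The type-`p` Wasserstein ball of probability distributions on `ℝ`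
(absolute-value norm). -/
def WballReal (p : ℝ≥0∞) (μ₀ : Measure ℝ) (ε : ℝ) : Set (Measure ℝ) :=
  {μ | IsProbabilityMeasure μ ∧ HasMomentP (fun x : ℝ => |x|) p μ ∧
    WassersteinD (fun x y : ℝ => ENNReal.ofReal |x - y|) p μ μ₀ ≤ ENNReal.ofReal ε}

/-- The metric on `Ξ = {-1,1} × ℝⁿ`:
`d((y₁,x₁),(y₂,x₂)) = ‖x₁ - x₂‖` if `y₁ = y₂`, and `+∞` otherwise. -/
def xiCost {n : ℕ} (nrm : Vec n → ℝ) (z₁ z₂ : ℝ × Vec n) : ℝ≥0∞ :=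
  if z₁.1 = z₂.1 then ENNReal.ofReal (nrm (z₁.2 - z₂.2)) else ∞

/-- A measure on `ℝ × ℝⁿ` is concentrated on `Ξ = {-1,1} × ℝⁿ`. -/
def OnXi {n : ℕ} (μ : Measure (ℝ × Vec n)) : Prop :=
  μ {z | z.1 = 1 ∨ z.1 = -1} = 1

/-- The type-`p` Wasserstein ball `B̄_p(F₀,ε)` of probability distributions on
`Ξ = {-1,1} × ℝⁿ`. -/
def WballXi {n : ℕ} (nrm : Vec n → ℝ) (p : ℝ≥0∞) (μ₀ : Measure (ℝ × Vec n)) (ε : ℝ) :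
    Set (Measure (ℝ × Vec n)) :=
  {μ | IsProbabilityMeasure μ ∧ OnXi μ ∧ HasMomentP (fun z => nrm z.2) p μ ∧
    WassersteinD (xiCost nrm) p μ μ₀ ≤ ENNReal.ofReal ε}

/-- The four loss functions of Theorem 6 of the paper:
`ℓ₁(x) = (x-m)₊`, `ℓ₂(x) = (m-x)₊`, `ℓ₃(x) = (|x-m₁|-m₂)₊`, `ℓ₄(x) = |x-m| + b` (`b > 0`). -/
def IsCanonicalLoss (ℓ : ℝ → ℝ) : Prop :=
  (∃ m : ℝ, ℓ = fun x => max (x - m) 0) ∨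
  (∃ m : ℝ, ℓ = fun x => max (m - x) 0) ∨
  (∃ m₁ m₂ : ℝ, 0 ≤ m₂ ∧ ℓ = fun x => max (|x - m₁| - m₂) 0) ∨
  (∃ m b : ℝ, 0 < b ∧ ℓ = fun x => |x - m| + b)

namespace IsNorm

variable {n : ℕ} {nrm : Vec n → ℝ}

lemma nonneg (h : IsNorm nrm) (x : Vec n) : 0 ≤ nrm x := by
  have h0 : nrm 0 = 0 := (h.1 0).2 rfl
  have h1 := h.2.2 x (-x)
  have h2 : nrm (-x) = nrm x := by simpa using h.2.1 (-1) x
  rw [add_neg_cancel, h0, h2] at h1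
  linarith

lemma continuous (h : IsNorm nrm) : Continuous nrm := by
  have hc : ConvexOn ℝ univ nrm := by
    refine ⟨convex_univ, fun x _ y _ a b ha hb _ ↦ (h.2.2 _ _).trans_eq ?_⟩
    rw [h.2.1, h.2.1, abs_of_nonneg ha, abs_of_nonneg hb, smul_eq_mul, smul_eq_mul]
  exact hc.locallyLipschitz.continuous

lemma exists_eq_one (h : IsNorm nrm) (hn : 0 < n) : ∃ x, nrm x = 1 := by
  set e : Vec n := Pi.single ⟨0, hn⟩ 1
  have he : nrm e ≠ 0 := fun h0 ↦ by simpa [e] using congrFun ((h.1 e).1 h0) ⟨0, hn⟩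
  refine ⟨(nrm e)⁻¹ • e, ?_⟩
  rw [h.2.1, abs_of_nonneg (inv_nonneg.2 (h.nonneg e)), inv_mul_cancel₀ he]

/-- Hahn–Banach: a norming functional at a unit vector. -/
lemma exists_norming (h : IsNorm nrm) {x₀ : Vec n} (hx₀ : nrm x₀ = 1) :
    ∃ β : Vec n, dotp β x₀ = 1 ∧ ∀ x, dotp β x ≤ nrm x := by
  have hne : x₀ ≠ 0 := fun h0 ↦ by simp [(h.1 x₀).2 h0] at hx₀
  obtain ⟨g, hg, hgN⟩ := exists_extension_of_le_sublinear
    (LinearPMap.mkSpanSingleton (K := ℝ) (L := ℝ) (σ := RingHom.id ℝ) x₀ (1 : ℝ) hne) nrm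
    (fun c hc x ↦ by rw [h.2.1, abs_of_pos hc]) h.2.2 (by
      rintro ⟨x, hx⟩
      obtain ⟨c, rfl⟩ := Submodule.mem_span_singleton.1 hx
      rw [LinearPMap.mkSpanSingleton'_apply]
      simpa [h.2.1, hx₀] using le_abs_self c)
  have hdot : ∀ x, dotp (fun i ↦ g fun j ↦ if i = j then 1 else 0) x = g x := fun x ↦ by
    rw [LinearMap.pi_apply_eq_sum_univ g x]
    exact Finset.sum_congr rfl fun i _ ↦ mul_comm _ _
  refine ⟨_, ?_, fun x ↦ (hdot x).trans_le (hgN x)⟩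
  rw [hdot]
  exact (hg ⟨x₀, Submodule.mem_span_singleton_self x₀⟩).trans
    (LinearPMap.mkSpanSingleton_apply ℝ ℝ hne 1)

end IsNorm

lemma dotp_add {n : ℕ} (β x y : Vec n) : dotp β (x + y) = dotp β x + dotp β y := by
  simp [dotp, mul_add, Finset.sum_add_distrib]

lemma dotp_smul {n : ℕ} (β : Vec n) (t : ℝ) (x : Vec n) : dotp β (t • x) = t * dotp β x := by
  simp only [dotp, Pi.smul_apply, smul_eq_mul, Finset.mul_sum]
  exact Finset.sum_congr rfl fun i _ ↦ by ring

lemma abs_dotp_le {n : ℕ} {nrm : Vec n → ℝ} (h : IsNorm nrm) {β : Vec n}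
    (hβ : ∀ x, dotp β x ≤ nrm x) (x : Vec n) : |dotp β x| ≤ nrm x := by
  refine abs_le.2 ⟨?_, hβ x⟩
  have h1 := hβ ((-1 : ℝ) • x)
  rw [dotp_smul, h.2.1] at h1
  norm_num at h1
  linarith

lemma dualNorm_eq_one {n : ℕ} {nrm : Vec n → ℝ} {β x₀ : Vec n} (hx₀ : nrm x₀ = 1)
    (h₀ : dotp β x₀ = 1) (hβ : ∀ x, dotp β x ≤ nrm x) : dualNorm nrm β = 1 :=
  IsGreatest.csSup_eq ⟨⟨x₀, hx₀.le, h₀.symm⟩, by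
    rintro _ ⟨x, hx, rfl⟩
    exact (hβ x).trans hx⟩

/-- The only coupling with a Dirac mass is the product one. -/
lemma wassersteinD_dirac {E : Type*} [MeasurableSpace E] [MeasurableSingletonClass E]
    {cost : E → E → ℝ≥0∞} {p : ℝ≥0∞} (hp : p ≠ ∞) (μ : Measure E) [IsProbabilityMeasure μ]
    (z : E) (hc : Measurable fun x ↦ cost x z) :
    WassersteinD cost p μ (Measure.dirac z)
      = (∫⁻ x, cost x z ^ p.toReal ∂μ) ^ (1 / p.toReal) := by
  have key : ∀ π ∈ Couplings μ (Measure.dirac z),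
      ∫⁻ w, cost w.1 w.2 ^ p.toReal ∂π = ∫⁻ x, cost x z ^ p.toReal ∂μ := by
    rintro π ⟨-, h1, h2⟩
    have hae : ∀ᵐ w ∂π, w.2 = z := by
      refine ae_of_ae_map measurable_snd.aemeasurable (p := fun y ↦ y = z) ?_
      rw [h2, ae_dirac_eq]
      rfl
    rw [← h1, lintegral_map (hc.pow_const _) measurable_fst]
    refine lintegral_congr_ae ?_
    filter_upwards [hae] with w hw
    rw [hw]
  rw [WassersteinD, if_neg hp]
  refine le_antisymm ?_ (le_iInf₂ fun π hπ ↦ by rw [key π hπ])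
  have hmem : μ.prod (Measure.dirac z) ∈ Couplings μ (Measure.dirac z) :=
    ⟨inferInstance, by simp, by simp⟩
  exact (iInf₂_le _ hmem).trans_eq (by rw [key _ hmem])

section Ball

variable {n : ℕ} {nrm : Vec n → ℝ} {p : ℕ}

lemma hasMomentP_dirac (z : Vec n) :
    HasMomentP nrm (p : ℝ≥0∞) (Measure.dirac z) := by
  rw [HasMomentP, if_neg (ENNReal.natCast_ne_top p), lintegral_dirac]
  simp

lemma IsNorm.lintegral_le_of_mem_ball (h : IsNorm nrm) (hp : p ≠ 0) {z : Vec n} {ε : ℝ}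
    (hε : 0 ≤ ε) {F : Measure (Vec n)}
    (hF : F ∈ WballVec nrm (p : ℝ≥0∞) (Measure.dirac z) ε) :
    ∫⁻ x, ENNReal.ofReal (nrm (x - z) ^ p) ∂F ≤ ENNReal.ofReal (ε ^ p) := by
  obtain ⟨hF1, -, hF2⟩ := hF
  have hm : Measurable fun x ↦ ENNReal.ofReal (nrm (x - z)) :=
    ENNReal.measurable_ofReal.comp
      (h.continuous.measurable.comp (measurable_id.sub measurable_const))
  rw [wassersteinD_dirac (ENNReal.natCast_ne_top p) F z hm, one_div,
    ENNReal.rpow_inv_le_iff (by simpa using Nat.pos_of_ne_zero hp)] at hF2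
  simpa [ENNReal.ofReal_pow, h.nonneg, hε] using hF2

lemma IsNorm.integrable_of_mem_ball (h : IsNorm nrm) (hp : p ≠ 0) {z : Vec n} {ε : ℝ}
    (hε : 0 ≤ ε) {F : Measure (Vec n)}
    (hF : F ∈ WballVec nrm (p : ℝ≥0∞) (Measure.dirac z) ε) :
    Integrable (fun x ↦ nrm (x - z) ^ p) F := by
  refine ⟨((h.continuous.comp (continuous_id.sub continuous_const)).pow p).aestronglyMeasurable,
    ?_⟩
  rw [hasFiniteIntegral_iff_ofReal (.of_forall fun x ↦ pow_nonneg (h.nonneg _) _)]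
  exact (h.lintegral_le_of_mem_ball hp hε hF).trans_lt ENNReal.ofReal_lt_top

lemma IsNorm.integral_le_of_mem_ball (h : IsNorm nrm) (hp : p ≠ 0) {z : Vec n} {ε : ℝ}
    (hε : 0 ≤ ε) {F : Measure (Vec n)}
    (hF : F ∈ WballVec nrm (p : ℝ≥0∞) (Measure.dirac z) ε) :
    ∫ x, nrm (x - z) ^ p ∂F ≤ ε ^ p := by
  rw [integral_eq_lintegral_of_nonneg_ae (.of_forall fun x ↦ pow_nonneg (h.nonneg _) _)
    (h.integrable_of_mem_ball hp hε hF).1]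
  exact ENNReal.toReal_le_of_le_ofReal (pow_nonneg hε p) (h.lintegral_le_of_mem_ball hp hε hF)

lemma IsNorm.dirac_mem_ball (h : IsNorm nrm) (hp : p ≠ 0) {y z : Vec n} {ε : ℝ}
    (hyz : nrm (y - z) ≤ ε) :
    Measure.dirac y ∈ WballVec nrm (p : ℝ≥0∞) (Measure.dirac z) ε := by
  have hm : Measurable fun x ↦ ENNReal.ofReal (nrm (x - z)) :=
    ENNReal.measurable_ofReal.comp
      (h.continuous.measurable.comp (measurable_id.sub measurable_const))
  refine ⟨inferInstance, hasMomentP_dirac y, ?_⟩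
  rw [wassersteinD_dirac (ENNReal.natCast_ne_top p) _ z hm, lintegral_dirac, one_div,
    ENNReal.rpow_rpow_inv (by simpa using hp)]
  exact ENNReal.ofReal_le_ofReal hyz

end Ball

/-- Weighted power mean inequality: the tangent at `s = 1` of a function concave in `s ^ p`. -/
lemma add_mul_pow_le {b c s : ℝ} {p : ℕ} (hp : 2 ≤ p) (hb : 0 < b) (hc : 0 < c) (hs : 0 ≤ s) :
    (b + c * s) ^ p ≤ (b + c) ^ (p - 1) * (b + c * s ^ p) ∧
      (s ≠ 1 → (b + c * s) ^ p < (b + c) ^ (p - 1) * (b + c * s ^ p)) := by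
  have hbc : 0 < b + c := by positivity
  have e1 : b + c * s = (b + c) * (b / (b + c) * 1 + c / (b + c) * s) := by field_simp
  have e2 : (b + c) ^ (p - 1) * (b + c * s ^ p)
      = (b + c) ^ p * (b / (b + c) * 1 ^ p + c / (b + c) * s ^ p) := by
    obtain ⟨q, rfl⟩ : ∃ q, p = q + 1 := ⟨p - 1, by omega⟩
    rw [Nat.add_sub_cancel, pow_succ (b + c), one_pow]
    field_simp
  have hlt : s ≠ 1 → (b + c * s) ^ p < (b + c) ^ (p - 1) * (b + c * s ^ p) := fun h ↦ by
    have := (strictConvexOn_pow hp).2 (show (1 : ℝ) ∈ Ici 0 by simp) (show s ∈ Ici 0 from hs)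
      h.symm (show 0 < b / (b + c) by positivity) (show 0 < c / (b + c) by positivity)
      (by field_simp)
    simp only [smul_eq_mul] at this
    rw [e2, e1, mul_pow]
    gcongr
  refine ⟨?_, hlt⟩
  rcases eq_or_ne s 1 with rfl | h
  · obtain ⟨q, rfl⟩ : ∃ q, p = q + 1 := ⟨p - 1, by omega⟩
    simp [pow_succ]
  · exact (hlt h).le

open Filter in
/-- If `ℓ` stays below the cone `b + c |t|` and is strictly below it at `±1`, then the tangent
bound of `add_mul_pow_le` is uniformly strict. -/
lemma exists_uniform_gap {ℓ : ℝ → ℝ} (hcont : Continuous ℓ) (hpos : ∀ x, 0 ≤ ℓ x)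
    {x b c : ℝ} {p : ℕ} (hp : 2 ≤ p) (hb : 0 < b) (hc : 0 < c)
    (hle : ∀ t, ℓ (x + t) ≤ b + c * |t|)
    (h1 : ℓ (x + 1) < b + c) (h2 : ℓ (x - 1) < b + c) :
    ∃ γ > 0, ∀ t, ℓ (x + t) ^ p + γ ≤ (b + c) ^ (p - 1) * (b + c * |t| ^ p) := by
  set φ : ℝ → ℝ := fun t ↦ (b + c) ^ (p - 1) * (b + c * |t| ^ p) - ℓ (x + t) ^ p with hφ
  have hφc : Continuous φ := by fun_prop
  have hpow : ∀ t, ℓ (x + t) ^ p ≤ (b + c * |t|) ^ p := fun t ↦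
    pow_le_pow_left₀ (hpos _) (hle t) p
  have hφpos : ∀ t, 0 < φ t := by
    intro t
    rw [hφ, sub_pos]
    by_cases ht : |t| = 1
    · have hlt : ℓ (x + t) < b + c := by
        rcases (abs_eq zero_le_one).1 ht with rfl | rfl
        · exact h1
        · simpa [sub_eq_add_neg] using h2
      have hlt' := pow_lt_pow_left₀ hlt (hpos _) (show p ≠ 0 by omega)
      rw [ht, one_pow, mul_one]
      obtain ⟨q, rfl⟩ : ∃ q, p = q + 1 := ⟨p - 1, by omega⟩
      rwa [Nat.add_sub_cancel, ← pow_succ]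
    · exact (hpow t).trans_lt ((add_mul_pow_le hp hb hc (abs_nonneg t)).2 ht)
  set κ : ℝ := ((b + c) ^ (p - 1) - (b / 2 + c) ^ (p - 1)) * c with hκ
  have hκpos : 0 < κ := by
    refine mul_pos (sub_pos.2 (pow_lt_pow_left₀ (by linarith) (by positivity) (by omega))) hc
  have hlow : ∀ t, κ * (|t| - 1) - (b + 2 * c) ^ (p - 1) * b ≤ φ t := by
    intro t
    have h3 := (add_mul_pow_le (s := |t| / 2) hp hb (show 0 < 2 * c by positivity)
      (by positivity)).1
    have h4 : (b + 2 * c) ^ (p - 1) * (b + 2 * c * (|t| / 2) ^ p)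
        = (b + 2 * c) ^ (p - 1) * b + (b / 2 + c) ^ (p - 1) * c * |t| ^ p := by
      obtain ⟨q, rfl⟩ : ∃ q, p = q + 1 := ⟨p - 1, by omega⟩
      have : b / 2 + c = (b + 2 * c) / 2 := by ring
      rw [Nat.add_sub_cancel, this, div_pow, div_pow, pow_succ 2]
      field_simp
    have h5 : (b + c * |t|) ^ p = (b + 2 * c * (|t| / 2)) ^ p := by ring_nf
    have h6 : |t| - 1 ≤ |t| ^ p := by
      rcases le_total |t| 1 with h | h
      · exact (sub_nonpos.2 h).trans (by positivity)
      · linarith [le_self_pow₀ h (show p ≠ 0 by omega)]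
    have h7 := mul_le_mul_of_nonneg_left h6 hκpos.le
    have h8 : 0 ≤ (b + c) ^ (p - 1) * b := by positivity
    have h9 := hpow t
    rw [h5] at h9
    rw [h4] at h3
    simp only [hφ]
    rw [hκ] at h7 ⊢
    linarith
  have htend : Tendsto φ (cocompact ℝ) atTop := by
    refine tendsto_atTop_mono hlow (tendsto_atTop_add_const_right _ _ ?_)
    refine Tendsto.const_mul_atTop hκpos (tendsto_atTop_add_const_right _ _ ?_)
    exact tendsto_norm_cocompact_atTop
  obtain ⟨t₀, ht₀⟩ := hφc.exists_forall_le htend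
  exact ⟨φ t₀, hφpos t₀, fun t ↦ by linarith [ht₀ t]⟩

section Worst

variable {n : ℕ} {nrm : Vec n → ℝ} {ℓ : ℝ → ℝ} {p : ℕ} {C : ℝ} {β x₀ : Vec n}

/-- The worst-case expectation of `ℓ(β^⊤Z)^p` over the ball of radius `ε` about `z`. -/
def worst (nrm : Vec n → ℝ) (ℓ : ℝ → ℝ) (p : ℕ) (β z : Vec n) (ε : ℝ) : ℝ :=
  sSup {s | ∃ F ∈ WballVec nrm (p : ℝ≥0∞) (Measure.dirac z) ε, s = ∫ x, ℓ (dotp β x) ^ p ∂F}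

lemma le_cone_of_worst (h : IsNorm nrm) (hpos : ∀ x, 0 ≤ ℓ x) (hp : p ≠ 0) (hC : 0 < C)
    (hx₀ : nrm x₀ = 1) (h₀ : dotp β x₀ = 1)
    (hw : ∀ t ε, 0 ≤ ε → worst nrm ℓ p β (t • x₀) ε = (ℓ t + C * ε) ^ p) (x t : ℝ) :
    ℓ (x + t) ≤ ℓ x + C * |t| := by
  rcases eq_or_ne t 0 with rfl | ht
  · simp
  have ht' : 0 < |t| := abs_pos.2 ht
  have hsum : 0 < ℓ x + C * |t| := add_pos_of_nonneg_of_pos (hpos x) (by positivity)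
  have hwx := hw x |t| ht'.le
  have hbdd : BddAbove {s | ∃ F ∈ WballVec nrm (p : ℝ≥0∞) (Measure.dirac (x • x₀)) |t|,
      s = ∫ x, ℓ (dotp β x) ^ p ∂F} := by
    by_contra hb
    rw [worst, Real.sSup_of_not_bddAbove hb] at hwx
    exact (pow_pos hsum p).ne hwx
  have hmem : Measure.dirac ((x + t) • x₀)
      ∈ WballVec nrm (p : ℝ≥0∞) (Measure.dirac (x • x₀)) |t| := by
    refine h.dirac_mem_ball hp ?_
    rw [← sub_smul, h.2.1, hx₀]
    simp
  have hle := le_csSup hbdd ⟨_, hmem, rfl⟩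
  rw [integral_dirac, dotp_smul, h₀, mul_one] at hle
  exact (pow_le_pow_iff_left₀ (hpos _) hsum.le hp).1 (hle.trans_eq hwx)

lemma eq_cone_of_worst (h : IsNorm nrm) (hcont : Continuous ℓ) (hpos : ∀ x, 0 ≤ ℓ x)
    (hp : 2 ≤ p) (hC : 0 < C) (hx₀ : nrm x₀ = 1) (h₀ : dotp β x₀ = 1)
    (hβ : ∀ x, dotp β x ≤ nrm x)
    (hw : ∀ t ε, 0 ≤ ε → worst nrm ℓ p β (t • x₀) ε = (ℓ t + C * ε) ^ p)
    {x : ℝ} (hx : 0 < ℓ x) : ℓ (x + 1) = ℓ x + C ∨ ℓ (x - 1) = ℓ x + C := by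
  have hp0 : p ≠ 0 := by omega
  have hcone := le_cone_of_worst h hpos hp0 hC hx₀ h₀ hw x
  by_contra! hne
  have h1 : ℓ (x + 1) < ℓ x + C := lt_of_le_of_ne (by simpa using hcone 1) hne.1
  have h2 : ℓ (x - 1) < ℓ x + C :=
    lt_of_le_of_ne (by simpa [sub_eq_add_neg] using hcone (-1)) hne.2
  obtain ⟨γ, hγ, hgap⟩ := exists_uniform_gap hcont hpos hp hx hC hcone h1 h2
  have hle : worst nrm ℓ p β (x • x₀) 1 ≤ (ℓ x + C) ^ p - γ := by
    refine csSup_le ⟨_, _, h.dirac_mem_ball hp0 (y := x • x₀) ?_, rfl⟩ ?_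
    · rw [sub_self, (h.1 0).2 rfl]
      exact zero_le_one
    rintro _ ⟨F, hF, rfl⟩
    have hF1 : IsProbabilityMeasure F := hF.1
    have hi := h.integrable_of_mem_ball hp0 zero_le_one hF
    have hI := h.integral_le_of_mem_ball hp0 zero_le_one hF
    set A := (ℓ x + C) ^ (p - 1) with hA
    have hApos : 0 < A := by positivity
    have hpt : ∀ y, ℓ (dotp β y) ^ p
        ≤ A * (ℓ x + C * nrm (y - x • x₀) ^ p) - γ := by
      intro y
      have e : dotp β y = x + dotp β (y - x • x₀) := by
        conv_lhs => rw [← add_sub_cancel (x • x₀) y, dotp_add, dotp_smul, h₀, mul_one]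
      have h3 := hgap (dotp β (y - x • x₀))
      have h4 : |dotp β (y - x • x₀)| ^ p ≤ nrm (y - x • x₀) ^ p :=
        pow_le_pow_left₀ (abs_nonneg _) (abs_dotp_le h hβ _) p
      rw [e]
      refine (le_sub_iff_add_le.2 h3).trans ?_
      gcongr
    have hint : Integrable (fun y ↦ A * (ℓ x + C * nrm (y - x • x₀) ^ p)) F :=
      ((integrable_const _).add (hi.const_mul C)).const_mul A
    calc ∫ y, ℓ (dotp β y) ^ p ∂F
        ≤ ∫ y, (A * (ℓ x + C * nrm (y - x • x₀) ^ p) - γ) ∂F :=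
          integral_mono_of_nonneg (.of_forall fun y ↦ pow_nonneg (hpos _) p)
            (hint.sub (integrable_const γ)) (.of_forall hpt)
      _ = A * (ℓ x + C * ∫ y, nrm (y - x • x₀) ^ p ∂F) - γ := by
          rw [integral_sub hint (integrable_const γ), integral_const_mul,
            integral_add (integrable_const _) (hi.const_mul C), integral_const_mul]
          simp
      _ ≤ A * (ℓ x + C * 1 ^ p) - γ := by gcongr
      _ = (ℓ x + C) ^ p - γ := by
          rw [one_pow, mul_one, hA, ← pow_succ, Nat.sub_add_cancel (by omega)]
  rw [hw x 1 zero_le_one, mul_one] at hle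
  linarith

lemma exists_pos_of_worst (hpos : ∀ x, 0 ≤ ℓ x) (hp : p ≠ 0) (hC : 0 < C)
    (hw : ∀ t ε, 0 ≤ ε → worst nrm ℓ p β (t • x₀) ε = (ℓ t + C * ε) ^ p) : ∃ x, 0 < ℓ x := by
  by_contra! hall
  have h0 : ∀ x, ℓ x = 0 := fun x ↦ le_antisymm (hall x) (hpos x)
  have hle : worst nrm ℓ p β ((0 : ℝ) • x₀) 1 ≤ 0 := by
    refine Real.sSup_le ?_ le_rfl
    rintro _ ⟨F, -, rfl⟩
    simp [h0, hp]
  rw [hw 0 1 zero_le_one, h0] at hle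
  have : 0 < (0 + C * 1) ^ p := by positivity
  linarith

end Worst

section Shape

variable {ℓ : ℝ → ℝ} {C : ℝ}

lemma right_ray (hconv : ConvexOn ℝ univ ℓ) (hcone : ∀ x t, ℓ (x + t) ≤ ℓ x + C * |t|)
    {x : ℝ} (hx : ℓ (x + 1) = ℓ x + C) {y : ℝ} (hy : x ≤ y) : ℓ y = ℓ x + C * (y - x) := by
  have hup : ℓ y ≤ ℓ x + C * (y - x) := by
    simpa [abs_of_nonneg (sub_nonneg.2 hy)] using hcone x (y - x)
  refine le_antisymm hup ?_
  rcases le_or_gt y (x + 1) with h | h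
  · have := hcone y (x + 1 - y)
    rw [add_sub_cancel, abs_of_nonneg (by linarith), hx] at this
    linarith
  · have hs := hconv.slope_mono_adjacent (mem_univ x) (mem_univ y)
      (show x < x + 1 by linarith) h
    rw [hx, le_div_iff₀ (by linarith)] at hs
    ring_nf at hs ⊢
    linarith

lemma right_kink (hpos : ∀ x, 0 ≤ ℓ x) (hC : 0 < C) (hconv : ConvexOn ℝ univ ℓ)
    (hcone : ∀ x t, ℓ (x + t) ≤ ℓ x + C * |t|)
    (heq : ∀ x, 0 < ℓ x → ℓ (x + 1) = ℓ x + C ∨ ℓ (x - 1) = ℓ x + C)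
    (hleft : ∀ x, ℓ (x - 1) = ℓ x + C → ∀ y ≤ x, ℓ y = ℓ x + C * (x - y))
    {z w : ℝ} (hz : ℓ z = 0) (hzw : z ≤ w) (hw : 0 < ℓ w) :
    ∃ b, z ≤ b ∧ ∀ x, z ≤ x → ℓ x = C * max (x - b) 0 := by
  have hray : ∀ v, z ≤ v → 0 < ℓ v → ∀ y, v ≤ y → ℓ y = ℓ v + C * (y - v) := by
    intro v hv hv0 y hy
    refine right_ray hconv hcone ((heq v hv0).resolve_right fun hl ↦ ?_) hy
    have h1 := hleft v hl z hv
    have h2 : 0 ≤ C * (v - z) := mul_nonneg hC.le (by linarith)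
    linarith
  have hb : C * (ℓ w / C) = ℓ w := mul_div_cancel₀ _ hC.ne'
  refine ⟨w - ℓ w / C, ?_, fun x hx ↦ ?_⟩
  · have h1 := hcone z (w - z)
    rw [add_sub_cancel, abs_of_nonneg (by linarith), hz] at h1
    have : 0 ≤ C * (w - ℓ w / C - z) := by linarith
    linarith [nonneg_of_mul_nonneg_right this hC]
  · rcases (hpos x).eq_or_lt with h0 | h0
    · have hxw : x ≤ w := by
        by_contra! hlt
        have h1 := hray w hzw hw x hlt.le
        have h2 : 0 ≤ C * (x - w) := mul_nonneg hC.le (by linarith)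
        linarith
      have h1 := hcone x (w - x)
      rw [add_sub_cancel, abs_of_nonneg (by linarith), ← h0] at h1
      have : 0 ≤ C * (w - ℓ w / C - x) := by linarith
      have := nonneg_of_mul_nonneg_right this hC
      rw [max_eq_right (by linarith), ← h0, mul_zero]
    · have hval : ℓ x = C * (x - (w - ℓ w / C)) := by
        rcases le_total x w with h | h
        · linarith [hray x hx h0 w h]
        · linarith [hray w hzw hw x h]
      rw [hval] at h0
      rw [hval, max_eq_left (pos_of_mul_pos_right h0 hC.le).le]

lemma shape (hcont : Continuous ℓ) (hpos : ∀ x, 0 ≤ ℓ x) (hconv : ConvexOn ℝ univ ℓ)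
    (hC : 0 < C) (hcone : ∀ x t, ℓ (x + t) ≤ ℓ x + C * |t|)
    (heq : ∀ x, 0 < ℓ x → ℓ (x + 1) = ℓ x + C ∨ ℓ (x - 1) = ℓ x + C)
    (hex : ∃ x, 0 < ℓ x) :
    ∃ ℓ' : ℝ → ℝ, IsCanonicalLoss ℓ' ∧ ℓ = fun x ↦ C * ℓ' x := by
  have hconv' : ConvexOn ℝ univ fun x ↦ ℓ (-x) := by
    refine ⟨convex_univ, fun x _ y _ a b ha hb hab ↦ ?_⟩
    have := hconv.2 (mem_univ (-x)) (mem_univ (-y)) ha hb hab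
    rwa [smul_neg, smul_neg, ← neg_add] at this
  have hcone' : ∀ x t, ℓ (-(x + t)) ≤ ℓ (-x) + C * |t| := fun x t ↦ by
    rw [neg_add]
    simpa using hcone (-x) (-t)
  have heq' : ∀ x, 0 < ℓ (-x) → ℓ (-(x + 1)) = ℓ (-x) + C ∨ ℓ (-(x - 1)) = ℓ (-x) + C := by
    intro x hx
    rw [show -(x + 1) = -x - 1 by ring, show -(x - 1) = -x + 1 by ring]
    exact (heq _ hx).symm
  have hright : ∀ x, ℓ (x + 1) = ℓ x + C → ∀ y, x ≤ y → ℓ y = ℓ x + C * (y - x) :=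
    fun x hx y hy ↦ right_ray hconv hcone hx hy
  have hleft : ∀ x, ℓ (x - 1) = ℓ x + C → ∀ y ≤ x, ℓ y = ℓ x + C * (x - y) := by
    intro x hx y hy
    have h1 : ℓ (-(-x + 1)) = ℓ (-(-x)) + C := by
      rwa [show -(-x + 1) = x - 1 by ring, neg_neg]
    have := right_ray (ℓ := fun x ↦ ℓ (-x)) hconv' hcone' h1 (neg_le_neg hy)
    simp only [neg_neg] at this
    rw [this]
    ring
  by_cases hzero : ∃ z, ℓ z = 0
  · obtain ⟨z, hz⟩ := hzero
    have hR : (∃ w, z ≤ w ∧ 0 < ℓ w) →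
        ∃ b, z ≤ b ∧ ∀ x, z ≤ x → ℓ x = C * max (x - b) 0 := fun ⟨w, hzw, hw⟩ ↦
      right_kink hpos hC hconv hcone heq hleft hz hzw hw
    have hL : (∃ w, w ≤ z ∧ 0 < ℓ w) →
        ∃ a, a ≤ z ∧ ∀ x, x ≤ z → ℓ x = C * max (a - x) 0 := by
      rintro ⟨w, hwz, hw⟩
      obtain ⟨b, hb, hbx⟩ := right_kink (ℓ := fun x ↦ ℓ (-x)) (z := -z) (w := -w)
        (fun x ↦ hpos _) hC hconv' hcone' heq'
        (fun x hx y hy ↦ by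
          have := hright (-x) (by rwa [show -x + 1 = -(x - 1) by ring]) (-y) (neg_le_neg hy)
          rw [this]
          ring)
        (by simpa using hz) (neg_le_neg hwz) (by simpa using hw)
      refine ⟨-b, by linarith, fun x hx ↦ ?_⟩
      have := hbx (-x) (neg_le_neg hx)
      rw [neg_neg] at this
      rw [this]
      ring_nf
    have hzero_of : ∀ {P : ℝ → Prop}, (¬∃ w, P w ∧ 0 < ℓ w) → ∀ x, P x → ℓ x = 0 :=
      fun hP x hx ↦ le_antisymm (not_lt.1 fun h ↦ hP ⟨x, hx, h⟩) (hpos x)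
    by_cases hr : ∃ w, z ≤ w ∧ 0 < ℓ w <;> by_cases hl : ∃ w, w ≤ z ∧ 0 < ℓ w
    · obtain ⟨b, hb, hbx⟩ := hR hr
      obtain ⟨a, ha, hax⟩ := hL hl
      refine ⟨_, .inr (.inr (.inl ⟨(a + b) / 2, (b - a) / 2, by linarith, rfl⟩)), ?_⟩
      funext x
      rcases le_total z x with h | h
      · rw [hbx x h]
        congr 1
        rcases le_total ((a + b) / 2) x with h' | h'
        · rw [abs_of_nonneg (by linarith)]
          ring_nf
        · rw [abs_of_nonpos (by linarith), max_eq_right (by linarith),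
            max_eq_right (by linarith)]
      · rw [hax x h]
        congr 1
        rcases le_total x ((a + b) / 2) with h' | h'
        · rw [abs_of_nonpos (by linarith)]
          ring_nf
        · rw [abs_of_nonneg (by linarith), max_eq_right (by linarith),
            max_eq_right (by linarith)]
    · obtain ⟨b, hb, hbx⟩ := hR hr
      refine ⟨_, .inl ⟨b, rfl⟩, ?_⟩
      funext x
      rcases le_total z x with h | h
      · exact hbx x h
      · rw [hzero_of hl x h, max_eq_right (by linarith), mul_zero]
    · obtain ⟨a, ha, hax⟩ := hL hl
      refine ⟨_, .inr (.inl ⟨a, rfl⟩), ?_⟩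
      funext x
      rcases le_total x z with h | h
      · exact hax x h
      · rw [hzero_of hr x h, max_eq_right (by linarith), mul_zero]
    · obtain ⟨x, hx⟩ := hex
      rcases le_total z x with h | h
      · exact absurd (hzero_of hr x h) hx.ne'
      · exact absurd (hzero_of hl x h) hx.ne'
  · have hpos' : ∀ x, 0 < ℓ x := fun x ↦
      (hpos x).lt_of_ne fun h ↦ hzero ⟨x, h.symm⟩
    have hx₁ : 0 ≤ ℓ 0 / C := div_nonneg (hpos 0) hC.le
    have hval : C * (ℓ 0 / C) = ℓ 0 := mul_div_cancel₀ _ hC.ne'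
    obtain ⟨m, -, hmR, hmL⟩ := isPreconnected_closed_iff.1 isPreconnected_univ
      {x | ℓ (x + 1) = ℓ x + C} {x | ℓ (x - 1) = ℓ x + C}
      (isClosed_eq (by fun_prop) (by fun_prop)) (isClosed_eq (by fun_prop) (by fun_prop))
      (fun x _ ↦ heq x (hpos' x))
      (by
        refine ⟨ℓ 0 / C, mem_univ _, (heq _ (hpos' _)).resolve_right fun hl ↦ ?_⟩
        have := hleft _ hl 0 hx₁
        rw [sub_zero, hval] at this
        linarith [hpos' (ℓ 0 / C)])
      (by
        refine ⟨-(ℓ 0 / C), mem_univ _, (heq _ (hpos' _)).resolve_left fun hr ↦ ?_⟩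
        have := hright _ hr 0 (by linarith)
        rw [zero_sub, neg_neg, hval] at this
        linarith [hpos' (-(ℓ 0 / C))])
    have hm : C * (ℓ m / C) = ℓ m := mul_div_cancel₀ _ hC.ne'
    refine ⟨_, .inr (.inr (.inr ⟨m, ℓ m / C, div_pos (hpos' m) hC, rfl⟩)), ?_⟩
    funext x
    rw [mul_add, hm]
    rcases le_total m x with h | h
    · rw [hright m hmR x h, abs_of_nonneg (by linarith), add_comm]
    · rw [hleft m hmL x h, abs_of_nonpos (by linarith), neg_sub, add_comm]

end Shape

/-- Theorem 7 of the paper, the "impossibility" theorem: if a nonnegative,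
Lipschitz, convex loss `ℓ` satisfies the exact regularization identity for all centers, radii
and feasible sets, then `ℓ` is `C` times one of the four canonical losses. -/
theorem stmt11 {n : ℕ} (hn : 0 < n) (nrm : Vec n → ℝ) (hnrm : IsNorm nrm)
    (ℓ : ℝ → ℝ) (hpos : ∀ x, 0 ≤ ℓ x) (hlip : ∃ K : ℝ≥0, LipschitzWith K ℓ)
    (hconv : ConvexOn ℝ Set.univ ℓ)
    (p : ℕ) (hp : 1 < p) (C : ℝ) (hC : 0 < C)
    (hreg : ∀ F₀ : Measure (Vec n), IsProbabilityMeasure F₀ →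
      HasMomentP nrm (p : ℝ≥0∞) F₀ → ∀ ε : ℝ, 0 ≤ ε → ∀ D : Set (Vec n),
        sInf {r | ∃ β ∈ D, r =
            sSup {s | ∃ F ∈ WballVec nrm (p : ℝ≥0∞) F₀ ε,
              s = ∫ x, ℓ (dotp β x) ^ (p : ℝ) ∂F}}
          = sInf {r | ∃ β ∈ D, r =
              ((∫ x, ℓ (dotp β x) ^ (p : ℝ) ∂F₀) ^ (1 / (p : ℝ))
                + C * ε * dualNorm nrm β) ^ (p : ℝ)}) :
    ∃ ℓ' : ℝ → ℝ, IsCanonicalLoss ℓ' ∧ ℓ = fun x => C * ℓ' x := by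
  have hp0 : p ≠ 0 := by omega
  obtain ⟨K, hK⟩ := hlip
  obtain ⟨x₀, hx₀⟩ := hnrm.exists_eq_one hn
  obtain ⟨β, h₀, hβ⟩ := hnrm.exists_norming hx₀
  have hw : ∀ t ε, 0 ≤ ε → worst nrm ℓ p β (t • x₀) ε = (ℓ t + C * ε) ^ p := by
    intro t ε hε
    have := hreg (Measure.dirac (t • x₀)) inferInstance (hasMomentP_dirac _) ε hε {β}
    simp only [mem_singleton_iff, exists_eq_left, Real.rpow_natCast, integral_dirac,
      dotp_smul, h₀, mul_one, dualNorm_eq_one hx₀ h₀ hβ, one_div,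
      Real.pow_rpow_inv_natCast (hpos t) hp0, Set.ofPred_eq_eq_singleton,
      csInf_singleton] at this
    exact this
  exact shape hK.continuous hpos hconv hC (le_cone_of_worst hnrm hpos hp0 hC hx₀ h₀ hw)
    (fun x ↦ eq_cone_of_worst hnrm hK.continuous hpos hp hC hx₀ h₀ hβ hw)
    (exists_pos_of_worst hpos hp0 hC hw)
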